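/- arXiv:2504.11490 — 3 statements merged into one kernel-verified Lean document; each statement's English description precedes it below -/
import Mathlib

section
/- Let J be an interval and f : J → (0, ∞) a log-convex differentiable function on the interior of J whose derivative f′ is continuous there, and suppose σ(T) ⊆ [m, M] ⊂ interior of J. Set K = f′(M)/f(M) − f′(m)/f(m). Then for every unit vector x ∈ E: 1 ≤ ⟨(t ↦ f(M)^{(t−m)/(M−m)} · f(m)^{(M−t)/(M−m)})(T) x, x⟩ / ⟨f(T) x, x⟩ ≤ ⟨(t ↦ f(t) · exp[ ((M−t)(t−m)/(M−m)) · K ])(T) x, x⟩ / ⟨f(T) x, x⟩ ≤ exp[ (1/4)·(M−m)·K ]. -/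
open scoped InnerProductSpace

lemma tangent_aux {S : Set ℝ} {g : ℝ → ℝ} (hg : ConvexOn ℝ S g) {a b d : ℝ}
    (ha : a ∈ S) (hb : b ∈ S) (hd : HasDerivAt g d a) : g a + d * (b - a) ≤ g b := by
  rcases lt_trichotomy a b with h | h | h
  · have := hg.le_slope_of_hasDerivAt ha hb h hd
    rw [slope_def_field, le_div_iff₀ (by linarith)] at this
    linarith
  · subst h; simp
  · have := hg.slope_le_of_hasDerivAt hb ha h hd
    rw [slope_def_field, div_le_iff₀ (by linarith)] at this
    linarith

lemma cfc_re_mono {E : Type*} [NormedAddCommGroup E] [InnerProductSpace ℂ E] [CompleteSpace E]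
    (T : E →L[ℂ] E) (m M : ℝ) (hspec : spectrum ℝ T ⊆ Set.Icc m M) (g h : ℝ → ℝ)
    (hg : ContinuousOn g (Set.Icc m M)) (hh : ContinuousOn h (Set.Icc m M))
    (hgh : ∀ t ∈ Set.Icc m M, g t ≤ h t) (x : E) :
    RCLike.re ⟪cfc g T x, x⟫_ℂ ≤ RCLike.re ⟪cfc h T x, x⟫_ℂ := by
  have h1 : cfc g T ≤ cfc h T :=
    cfc_mono (fun t ht => hgh t (hspec ht)) (hg.mono hspec) (hh.mono hspec)
  rw [ContinuousLinearMap.le_def] at h1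
  have h2 := h1.re_inner_nonneg_left x
  rw [ContinuousLinearMap.sub_apply, inner_sub_left, map_sub] at h2
  linarith

theorem lah_ribaric_ratio_bounds_log_convex
    {E : Type*} [NormedAddCommGroup E] [InnerProductSpace ℂ E] [CompleteSpace E]
    (T : E →L[ℂ] E) (hT : IsSelfAdjoint T) (m M : ℝ) (hmM : m < M)
    (J : Set ℝ) (hJ : J.OrdConnected)
    (f f' : ℝ → ℝ)
    (hderiv : ∀ t ∈ interior J, HasDerivAt f (f' t) t)
    (hf'_cont : ContinuousOn f' (interior J))
    (hIcc : Set.Icc m M ⊆ interior J)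
    (hspec : spectrum ℝ T ⊆ Set.Icc m M)
    (hf_pos : ∀ t ∈ interior J, 0 < f t)
    (hf_logconv : ConvexOn ℝ (interior J) (fun t => Real.log (f t)))
    (K : ℝ) (hK : K = f' M / f M - f' m / f m)
    (x : E) (hx : ‖x‖ = 1) :
    1 ≤ RCLike.re ⟪(cfc (fun t => f M ^ ((t - m) / (M - m)) *
          f m ^ ((M - t) / (M - m))) T) x, x⟫_ℂ /
        RCLike.re ⟪(cfc f T) x, x⟫_ℂ ∧
    RCLike.re ⟪(cfc (fun t => f M ^ ((t - m) / (M - m)) *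
          f m ^ ((M - t) / (M - m))) T) x, x⟫_ℂ /
        RCLike.re ⟪(cfc f T) x, x⟫_ℂ ≤
      RCLike.re ⟪(cfc (fun t => f t *
          Real.exp (((M - t) * (t - m) / (M - m)) * K)) T) x, x⟫_ℂ /
        RCLike.re ⟪(cfc f T) x, x⟫_ℂ ∧
    RCLike.re ⟪(cfc (fun t => f t *
          Real.exp (((M - t) * (t - m) / (M - m)) * K)) T) x, x⟫_ℂ /
        RCLike.re ⟪(cfc f T) x, x⟫_ℂ ≤
      Real.exp ((1 / 4) * (M - m) * K) := by
  have hd : 0 < M - m := by linarith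
  have hmI : m ∈ interior J := hIcc ⟨le_rfl, hmM.le⟩
  have hMI : M ∈ interior J := hIcc ⟨hmM.le, le_rfl⟩
  have hfm := hf_pos m hmI
  have hfM := hf_pos M hMI
  have hfc : ContinuousOn f (Set.Icc m M) := fun t ht =>
    (hderiv t (hIcc ht)).continuousAt.continuousWithinAt
  have tm : ∀ t ∈ Set.Icc m M, _ := fun t ht =>
    tangent_aux hf_logconv hmI (hIcc ht) ((hderiv m hmI).log hfm.ne')
  have tM : ∀ t ∈ Set.Icc m M, _ := fun t ht =>
    tangent_aux hf_logconv hMI (hIcc ht) ((hderiv M hMI).log hfM.ne')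
  have hK0 : 0 ≤ K := by
    have a := tm M ⟨hmM.le, le_rfl⟩
    have b := tM m ⟨le_rfl, hmM.le⟩
    have : 0 ≤ K * (M - m) := by rw [hK]; linarith
    exact nonneg_of_mul_nonneg_left this hd
  have hgc : ContinuousOn (fun t => f M ^ ((t - m) / (M - m)) *
          f m ^ ((M - t) / (M - m))) (Set.Icc m M) := by
    apply Continuous.continuousOn
    exact (Continuous.rpow continuous_const (by fun_prop) (fun _ => Or.inl hfM.ne')).mul
      (Continuous.rpow continuous_const (by fun_prop) (fun _ => Or.inl hfm.ne'))
  have hhc : ContinuousOn (fun t => f t *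
          Real.exp (((M - t) * (t - m) / (M - m)) * K)) (Set.Icc m M) :=
    hfc.mul (Continuous.continuousOn (by fun_prop))
  have hgexp : ∀ t, f M ^ ((t - m) / (M - m)) * f m ^ ((M - t) / (M - m)) =
      Real.exp ((t - m) / (M - m) * Real.log (f M) + (M - t) / (M - m) * Real.log (f m)) := by
    intro t
    rw [Real.rpow_def_of_pos hfM, Real.rpow_def_of_pos hfm, ← Real.exp_add]
    congr 1; ring
  have hsum : ∀ t, (t - m) / (M - m) + (M - t) / (M - m) = 1 := by
    intro t; field_simp; ring
  have h1 := cfc_re_mono T m M hspec _ _ hfc hgc (fun t ht => by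
    rw [hgexp, ← Real.log_le_iff_le_exp (hf_pos t (hIcc ht))]
    have := hf_logconv.2 hMI hmI (div_nonneg (by linarith [ht.1]) hd.le)
      (div_nonneg (by linarith [ht.2]) hd.le) (hsum t)
    simp only [smul_eq_mul] at this
    have e : (t - m) / (M - m) * M + (M - t) / (M - m) * m = t := by field_simp; ring
    rwa [e] at this) x
  have h2 := cfc_re_mono T m M hspec _ _ hgc hhc (fun t ht => by
    have hft := hf_pos t (hIcc ht)
    rw [hgexp]
    nth_rewrite 1 [← Real.exp_log hft]
    rw [← Real.exp_add, Real.exp_le_exp]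
    have a := mul_le_mul_of_nonneg_left (tM t ht)
      (div_nonneg (by linarith [ht.1]) hd.le : 0 ≤ (t - m) / (M - m))
    have b := mul_le_mul_of_nonneg_left (tm t ht)
      (div_nonneg (by linarith [ht.2]) hd.le : 0 ≤ (M - t) / (M - m))
    have e : Real.log (f t) = (t - m) / (M - m) * Real.log (f t)
        + (M - t) / (M - m) * Real.log (f t) := by rw [← add_mul, hsum, one_mul]
    have e2 : (M - t) * (t - m) / (M - m) * K =
      -((t - m) / (M - m) * (f' M / f M * (t - M)) + (M - t) / (M - m) * (f' m / f m * (t - m)))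
      := by rw [hK]; ring
    rw [e2]
    simp only [mul_add] at a b
    linarith) x
  have h3 := cfc_re_mono T m M hspec _ (fun t => Real.exp ((1 / 4) * (M - m) * K) * f t) hhc
    (continuousOn_const.mul hfc) (fun t ht => by
    rw [mul_comm]
    refine mul_le_mul_of_nonneg_right ?_ (hf_pos t (hIcc ht)).le
    rw [Real.exp_le_exp]
    refine mul_le_mul_of_nonneg_right ?_ hK0
    rw [div_le_iff₀ hd]
    nlinarith [sq_nonneg (M - t - (t - m))]) x
  rw [cfc_const_mul _ f T (hfc.mono hspec)] at h3
  have h3' : RCLike.re ⟪(Real.exp ((1 / 4) * (M - m) * K) • cfc f T) x, x⟫_ℂ =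
      Real.exp ((1 / 4) * (M - m) * K) * RCLike.re ⟪cfc f T x, x⟫_ℂ := by
    rw [ContinuousLinearMap.smul_apply, inner_smul_left_eq_smul, RCLike.smul_re]
  rw [h3'] at h3
  have hpos : 0 < RCLike.re ⟪cfc f T x, x⟫_ℂ := by
    obtain ⟨c, hc, hmin⟩ := isCompact_Icc.exists_isMinOn (Set.nonempty_Icc.2 hmM.le) hfc
    have h4 := cfc_re_mono T m M hspec (fun _ => f c) f continuousOn_const hfc
      (fun t ht => hmin ht) x
    rw [cfc_const _ T] at h4
    have h5 : RCLike.re ⟪(algebraMap ℝ (E →L[ℂ] E) (f c)) x, x⟫_ℂ = f c := by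
      rw [Algebra.algebraMap_eq_smul_one, ContinuousLinearMap.smul_apply,
        inner_smul_left_eq_smul, RCLike.smul_re, ContinuousLinearMap.one_apply,
        inner_self_eq_norm_sq, hx]
      simp
    rw [h5] at h4
    exact (hf_pos c (hIcc hc)).trans_le h4
  exact ⟨(one_le_div hpos).2 h1, div_le_div_of_nonneg_right h2 hpos.le, (div_le_iff₀ hpos).2 h3⟩
end

section
/- Let T be positive and invertible with σ(T) ⊆ [m, M] and 0 < m < M, and let r > 0. Then for every unit vector x ∈ E: 1 ≤ ⟨(t ↦ M^{−r(t−m)/(M−m)} · m^{−r(M−t)/(M−m)})(T) x, x⟩ / ⟨T^{−r} x, x⟩ ≤ ⟨(t ↦ t^{−r} · exp[ r·(M−t)(t−m)/(mM) ])(T) x, x⟩ / ⟨T^{−r} x, x⟩ ≤ exp[ (r/4)·(M−m)²/(mM) ]. -/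
open scoped InnerProductSpace

theorem lr_upper {m M t : ℝ} (h0m : 0 < m) (hmM : m < M) (h1 : m ≤ t) (h2 : t ≤ M) :
    Real.log t - ((t - m) * Real.log M + (M - t) * Real.log m) / (M - m)
      ≤ (M - t) * (t - m) / (m * M) := by
  have ht : 0 < t := by linarith
  have hM : 0 < M := by linarith
  have hd : 0 < M - m := by linarith
  have e1 := Real.log_le_sub_one_of_pos (div_pos ht hM)
  have e2 := Real.log_le_sub_one_of_pos (div_pos ht h0m)
  rw [Real.log_div ht.ne' hM.ne'] at e1
  rw [Real.log_div ht.ne' h0m.ne'] at e2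
  have f1 := mul_le_mul_of_nonneg_left e1 (sub_nonneg.2 h1)
  have f2 := mul_le_mul_of_nonneg_left e2 (sub_nonneg.2 h2)
  have key : (t - m) * (t / M - 1) + (M - t) * (t / m - 1)
      = (M - t) * (t - m) / (m * M) * (M - m) := by
    field_simp
    ring
  have : Real.log t - ((t - m) * Real.log M + (M - t) * Real.log m) / (M - m)
      = ((t - m) * (Real.log t - Real.log M) + (M - t) * (Real.log t - Real.log m)) / (M - m) := by
    field_simp
    ring
  rw [this, div_le_iff₀ hd]
  linarith

theorem lr_lower {m M t : ℝ} (h0m : 0 < m) (hmM : m < M) (h1 : m ≤ t) (h2 : t ≤ M) :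
    ((t - m) * Real.log M + (M - t) * Real.log m) / (M - m) ≤ Real.log t := by
  have ht : 0 < t := by linarith
  have hM : 0 < M := by linarith
  have hd : 0 < M - m := by linarith
  have e1 := Real.log_le_sub_one_of_pos (div_pos hM ht)
  have e2 := Real.log_le_sub_one_of_pos (div_pos h0m ht)
  rw [Real.log_div hM.ne' ht.ne'] at e1
  rw [Real.log_div h0m.ne' ht.ne'] at e2
  have f1 := mul_le_mul_of_nonneg_left e1 (sub_nonneg.2 h1)
  have f2 := mul_le_mul_of_nonneg_left e2 (sub_nonneg.2 h2)
  have key : (t - m) * (M / t - 1) + (M - t) * (m / t - 1) = 0 := by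
    field_simp
    ring
  rw [div_le_iff₀ hd]
  nlinarith

theorem lr_eq {m M : ℝ} (h0m : 0 < m) (hmM : m < M) (r t : ℝ) :
    M ^ (-r * (t - m) / (M - m)) * m ^ (-r * (M - t) / (M - m))
      = Real.exp (-r * (((t - m) * Real.log M + (M - t) * Real.log m) / (M - m))) := by
  rw [Real.rpow_def_of_pos (h0m.trans hmM), Real.rpow_def_of_pos h0m, ← Real.exp_add]
  congr 1
  ring

theorem lr_mono {E : Type*} [NormedAddCommGroup E] [InnerProductSpace ℂ E] [CompleteSpace E]
    (T : E →L[ℂ] E) (f g : ℝ → ℝ)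
    (hf : ContinuousOn f (spectrum ℝ T)) (hg : ContinuousOn g (spectrum ℝ T))
    (h : ∀ t ∈ spectrum ℝ T, f t ≤ g t) (x : E) :
    RCLike.re ⟪(cfc f T) x, x⟫_ℂ ≤ RCLike.re ⟪(cfc g T) x, x⟫_ℂ := by
  have h1 : cfc f T ≤ cfc g T := cfc_mono h hf hg
  rw [ContinuousLinearMap.le_def] at h1
  have h2 := h1.re_inner_nonneg_left x
  rw [ContinuousLinearMap.sub_apply, inner_sub_left, map_sub] at h2
  linarith

theorem lah_ribaric_ratio_bounds_neg_power
    {E : Type*} [NormedAddCommGroup E] [InnerProductSpace ℂ E] [CompleteSpace E]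
    (T : E →L[ℂ] E) (hT : IsSelfAdjoint T) (m M : ℝ) (h0m : 0 < m) (hmM : m < M)
    (hspec : spectrum ℝ T ⊆ Set.Icc m M)
    (hpos : ∀ y : E, 0 ≤ RCLike.re ⟪T y, y⟫_ℂ) (hinv : IsUnit T)
    (r : ℝ) (hr : 0 < r)
    (x : E) (hx : ‖x‖ = 1) :
    1 ≤ RCLike.re ⟪(cfc (fun t : ℝ => M ^ (-r * (t - m) / (M - m)) *
          m ^ (-r * (M - t) / (M - m))) T) x, x⟫_ℂ /
        RCLike.re ⟪(cfc (fun t : ℝ => t ^ (-r)) T) x, x⟫_ℂ ∧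
    RCLike.re ⟪(cfc (fun t : ℝ => M ^ (-r * (t - m) / (M - m)) *
          m ^ (-r * (M - t) / (M - m))) T) x, x⟫_ℂ /
        RCLike.re ⟪(cfc (fun t : ℝ => t ^ (-r)) T) x, x⟫_ℂ ≤
      RCLike.re ⟪(cfc (fun t : ℝ => t ^ (-r) *
          Real.exp (r * (M - t) * (t - m) / (m * M))) T) x, x⟫_ℂ /
        RCLike.re ⟪(cfc (fun t : ℝ => t ^ (-r)) T) x, x⟫_ℂ ∧
    RCLike.re ⟪(cfc (fun t : ℝ => t ^ (-r) *
          Real.exp (r * (M - t) * (t - m) / (m * M))) T) x, x⟫_ℂ /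
        RCLike.re ⟪(cfc (fun t : ℝ => t ^ (-r)) T) x, x⟫_ℂ ≤
      Real.exp ((r / 4) * (M - m) ^ 2 / (m * M)) := by
  have hM : 0 < M := h0m.trans hmM
  have hmem : ∀ t ∈ spectrum ℝ T, 0 < t ∧ m ≤ t ∧ t ≤ M := fun t ht =>
    ⟨h0m.trans_le (hspec ht).1, (hspec ht).1, (hspec ht).2⟩
  simp only [lr_eq h0m hmM]
  have cp : ContinuousOn (fun t : ℝ => t ^ (-r)) (spectrum ℝ T) := fun t ht =>
    (Real.continuousAt_rpow_const t (-r) (Or.inl (hmem t ht).1.ne')).continuousWithinAt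
  have ce : ContinuousOn (fun t : ℝ => Real.exp (-r * (((t - m) * Real.log M +
      (M - t) * Real.log m) / (M - m)))) (spectrum ℝ T) := by fun_prop
  have cq : ContinuousOn (fun t : ℝ => t ^ (-r) *
      Real.exp (r * (M - t) * (t - m) / (m * M))) (spectrum ℝ T) :=
    cp.mul (by fun_prop)
  have hpe : ∀ t ∈ spectrum ℝ T, t ^ (-r) = Real.exp (-r * Real.log t) := fun t ht => by
    rw [Real.rpow_def_of_pos (hmem t ht).1, mul_comm]
  have hden : 0 < RCLike.re ⟪(cfc (fun t : ℝ => t ^ (-r)) T) x, x⟫_ℂ := by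
    have h := lr_mono T (fun _ => M ^ (-r)) _ continuousOn_const cp (fun t ht =>
      Real.rpow_le_rpow_of_nonpos (hmem t ht).1 (hmem t ht).2.2 (by linarith)) x
    refine lt_of_lt_of_le ?_ h
    rw [cfc_const _ T hT, Algebra.algebraMap_eq_smul_one, ContinuousLinearMap.smul_apply,
      ContinuousLinearMap.one_apply, ← Complex.coe_smul, inner_smul_left,
      inner_self_eq_norm_sq_to_K, hx]
    have := Real.rpow_pos_of_pos hM (-r)
    simpa using this
  refine ⟨?_, ?_, ?_⟩
  · rw [one_le_div hden]
    refine lr_mono T _ _ cp ce (fun t ht => ?_) x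
    obtain ⟨-, h1, h2⟩ := hmem t ht
    simp only [hpe t ht]
    apply Real.exp_le_exp.2
    nlinarith [lr_lower h0m hmM h1 h2]
  · rw [div_le_div_iff_of_pos_right hden]
    refine lr_mono T _ _ ce cq (fun t ht => ?_) x
    obtain ⟨-, h1, h2⟩ := hmem t ht
    simp only [hpe t ht]
    rw [← Real.exp_add]
    apply Real.exp_le_exp.2
    have h3 := mul_le_mul_of_nonneg_left (lr_upper h0m hmM h1 h2) hr.le
    have h4 : r * (M - t) * (t - m) / (m * M) = r * ((M - t) * (t - m) / (m * M)) := by ring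
    rw [h4]
    linarith
  · rw [div_le_iff₀ hden]
    set C := Real.exp ((r / 4) * (M - m) ^ 2 / (m * M)) with hC
    have h := lr_mono T _ (fun t : ℝ => C * t ^ (-r)) cq (continuousOn_const.mul cp)
      (fun t ht => ?_) x
    · rw [cfc_const_mul C _ T cp] at h
      refine h.trans (le_of_eq ?_)
      rw [ContinuousLinearMap.smul_apply, ← Complex.coe_smul, inner_smul_left]
      simp
    · obtain ⟨h0, h1, h2⟩ := hmem t ht
      rw [mul_comm C]
      refine mul_le_mul_of_nonneg_left (Real.exp_le_exp.2 ?_) (Real.rpow_nonneg h0.le _)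
      apply div_le_div_of_nonneg_right _ (mul_pos h0m hM).le
      nlinarith [mul_nonneg hr.le (sq_nonneg (M + m - 2 * t))]
end

section
/- Let T be positive and invertible with σ(T) ⊆ [m, M] ⊂ (0, 1/2) where 0 < m < M, and let r > 0. Let g(t) = ((1−m)/m)^{r(M−t)/(M−m)} · ((1−M)/M)^{r(t−m)/(M−m)}. Then for every unit vector x ∈ E: (i) ⟨(t ↦ ((1−t)/t)^r)(T) x, x⟩ ≤ ⟨g(T) x, x⟩ ≤ ((M − ⟨Tx,x⟩)/(M−m))·((1−m)/m)^r + ((⟨Tx,x⟩ − m)/(M−m))·((1−M)/M)^r; and (ii) ((1 − ⟨Tx,x⟩)/⟨Tx,x⟩)^r ≤ ((1−m)/m)^{r(M−⟨Tx,x⟩)/(M−m)} · ((1−M)/M)^{r(⟨Tx,x⟩−m)/(M−m)} ≤ ⟨g(T) x, x⟩. -/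
open scoped InnerProductSpace

lemma aux_convex : ConvexOn ℝ (Set.Ioo (0:ℝ) (1/2)) (fun t => Real.log ((1 - t) / t)) := by
  apply convexOn_of_hasDerivWithinAt2_nonneg (convex_Ioo _ _)
    (f' := fun t => -1 / (1 - t) - 1 / t) (f'' := fun t => -1 / (1 - t)^2 + 1 / t^2)
  · intro t ht
    have h1 : (1 - t) / t ≠ 0 := div_ne_zero (by linarith [ht.2]) ht.1.ne'
    have h2 : t ≠ 0 := ht.1.ne'
    apply ContinuousAt.continuousWithinAt
    fun_prop (disch := assumption)
  · rw [interior_Ioo]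
    intro t ht
    have h3 : (1 - t) ≠ 0 := by linarith [ht.2]
    have h2 : t ≠ 0 := ht.1.ne'
    have h : HasDerivAt (fun t : ℝ => Real.log (1 - t) - Real.log t) (-1 / (1 - t) - 1 / t) t :=
      (((hasDerivAt_id t).const_sub 1).log h3).sub ((hasDerivAt_id t).log h2)
    refine h.hasDerivWithinAt.congr (fun y hy => ?_) ?_
    · exact Real.log_div (by linarith [hy.2]) hy.1.ne'
    · exact Real.log_div h3 h2
  · rw [interior_Ioo]
    intro t ht
    have h3 : (1 - t) ≠ 0 := by linarith [ht.2]
    have h2 : t ≠ 0 := ht.1.ne'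
    have h := (((hasDerivAt_const t (-1:ℝ)).div ((hasDerivAt_id t).const_sub 1) h3).sub
      ((hasDerivAt_const t (1:ℝ)).div (hasDerivAt_id t) h2))
    refine HasDerivAt.hasDerivWithinAt (h.congr_deriv ?_)
    simp
    ring
  · rw [interior_Ioo]
    intro t ht
    have h2 : 0 < t := ht.1
    have : 1 / (1 - t)^2 ≤ 1 / t^2 := by
      apply one_div_le_one_div_of_le (by positivity)
      nlinarith [ht.2]
    have e : -1 / (1 - t)^2 = - (1 / (1 - t)^2) := by ring
    rw [e]; linarith

lemma aux_mono {E : Type*} [NormedAddCommGroup E] [InnerProductSpace ℂ E] [CompleteSpace E]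
    (T : E →L[ℂ] E) (f h : ℝ → ℝ) (hf : ContinuousOn f (spectrum ℝ T))
    (hh : ContinuousOn h (spectrum ℝ T)) (hfh : ∀ t ∈ spectrum ℝ T, f t ≤ h t) (x : E) :
    RCLike.re ⟪(cfc f T) x, x⟫_ℂ ≤ RCLike.re ⟪(cfc h T) x, x⟫_ℂ := by
  have h1 : cfc f T ≤ cfc h T := cfc_mono hfh hf hh
  rw [ContinuousLinearMap.le_def] at h1
  have h2 := h1.re_inner_nonneg_left x
  simp only [ContinuousLinearMap.sub_apply, inner_sub_left, map_sub] at h2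
  linarith

lemma aux_affine {E : Type*} [NormedAddCommGroup E] [InnerProductSpace ℂ E] [CompleteSpace E]
    (T : E →L[ℂ] E) (hT : IsSelfAdjoint T) (c d : ℝ) (x : E) (hx : ‖x‖ = 1) :
    RCLike.re ⟪(cfc (fun t : ℝ => c + d * t) T) x, x⟫_ℂ = c + d * RCLike.re ⟪T x, x⟫_ℂ := by
  rw [cfc_const_add c (fun t => d * t) T (by fun_prop) hT, cfc_const_mul_id d T hT]
  have e : (algebraMap ℝ (E →L[ℂ] E) c) x = (c : ℂ) • x := by
    rw [Algebra.algebraMap_eq_smul_one]; simp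
  have e2 : (d • T) x = (d : ℂ) • T x := by simp
  rw [ContinuousLinearMap.add_apply, e, e2, inner_add_left, inner_smul_left, inner_smul_left,
    inner_self_eq_norm_sq_to_K, hx]
  simp

theorem lah_ribaric_ky_fan_function
    {E : Type*} [NormedAddCommGroup E] [InnerProductSpace ℂ E] [CompleteSpace E]
    (T : E →L[ℂ] E) (hT : IsSelfAdjoint T) (m M : ℝ) (h0m : 0 < m) (hmM : m < M)
    (hM : M < 1 / 2)
    (hspec : spectrum ℝ T ⊆ Set.Icc m M)
    (hpos : ∀ y : E, 0 ≤ RCLike.re ⟪T y, y⟫_ℂ) (hinv : IsUnit T)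
    (r : ℝ) (hr : 0 < r)
    (g : ℝ → ℝ)
    (hg : ∀ t, g t = ((1 - m) / m) ^ (r * (M - t) / (M - m)) *
        ((1 - M) / M) ^ (r * (t - m) / (M - m)))
    (x : E) (hx : ‖x‖ = 1) :
    (RCLike.re ⟪(cfc (fun t : ℝ => ((1 - t) / t) ^ r) T) x, x⟫_ℂ ≤
        RCLike.re ⟪(cfc g T) x, x⟫_ℂ ∧
      RCLike.re ⟪(cfc g T) x, x⟫_ℂ ≤
        ((M - RCLike.re ⟪T x, x⟫_ℂ) / (M - m)) * ((1 - m) / m) ^ r +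
        ((RCLike.re ⟪T x, x⟫_ℂ - m) / (M - m)) * ((1 - M) / M) ^ r) ∧
    (((1 - RCLike.re ⟪T x, x⟫_ℂ) / RCLike.re ⟪T x, x⟫_ℂ) ^ r ≤
        ((1 - m) / m) ^ (r * (M - RCLike.re ⟪T x, x⟫_ℂ) / (M - m)) *
        ((1 - M) / M) ^ (r * (RCLike.re ⟪T x, x⟫_ℂ - m) / (M - m)) ∧
      ((1 - m) / m) ^ (r * (M - RCLike.re ⟪T x, x⟫_ℂ) / (M - m)) *
        ((1 - M) / M) ^ (r * (RCLike.re ⟪T x, x⟫_ℂ - m) / (M - m)) ≤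
        RCLike.re ⟪(cfc g T) x, x⟫_ℂ) := by
  set s := RCLike.re ⟪T x, x⟫_ℂ with hs
  have hD : 0 < M - m := by linarith
  have hA : 0 < (1 - m) / m := div_pos (by linarith) h0m
  have hB : 0 < (1 - M) / M := div_pos (by linarith) (by linarith)
  set a := Real.log ((1 - m) / m) with ha
  set b := Real.log ((1 - M) / M) with hb
  have hgexp : ∀ t, g t = Real.exp (r * ((M - t) / (M - m) * a + (t - m) / (M - m) * b)) := by
    intro t
    rw [hg, Real.rpow_def_of_pos hA, Real.rpow_def_of_pos hB, ← Real.exp_add]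
    congr 1
    ring
  have hgc : Continuous g := by
    rw [show g = _ from funext hgexp]; fun_prop
  have hsum : ∀ t, (M - t) / (M - m) + (t - m) / (M - m) = 1 := by
    intro t; field_simp; ring
  have hkey : ∀ t ∈ Set.Icc m M, ((1 - t) / t) ^ r ≤ g t := by
    intro t ht
    have ht0 : 0 < t := by linarith [ht.1]
    have hp : 0 < (1 - t) / t := div_pos (by linarith [ht.2]) ht0
    rw [hgexp, Real.rpow_def_of_pos hp]
    apply Real.exp_le_exp.2
    rw [mul_comm]
    apply mul_le_mul_of_nonneg_left _ hr.le
    have h := aux_convex.2 (show m ∈ _ from ⟨h0m, by linarith⟩) (show M ∈ _ from ⟨by linarith, hM⟩)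
      (div_nonneg (sub_nonneg.2 ht.2) hD.le) (div_nonneg (sub_nonneg.2 ht.1) hD.le) (hsum t)
    have e : ((M - t) / (M - m)) • m + ((t - m) / (M - m)) • M = t := by
      simp only [smul_eq_mul]; field_simp; ring
    rw [e] at h
    exact h
  have hsm : s ∈ Set.Icc m M := by
    have h1 := aux_mono T (fun t => m + 0 * t) (fun t => 0 + 1 * t) (by fun_prop) (by fun_prop)
      (fun t ht => by linarith [(hspec ht).1]) x
    have h2 := aux_mono T (fun t => 0 + 1 * t) (fun t => M + 0 * t) (by fun_prop) (by fun_prop)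
      (fun t ht => by linarith [(hspec ht).2]) x
    rw [aux_affine T hT _ _ x hx, aux_affine T hT _ _ x hx] at h1 h2
    constructor <;> linarith
  refine ⟨⟨?_, ?_⟩, ?_, ?_⟩
  · refine aux_mono T _ _ ?_ hgc.continuousOn (fun t ht => hkey t (hspec ht)) x
    intro t ht
    have ht0 : t ≠ 0 := by linarith [(hspec ht).1]
    apply ContinuousAt.continuousWithinAt
    refine ContinuousAt.rpow_const ?_ (Or.inr hr.le)
    fun_prop (disch := assumption)
  · set P := ((1 - m) / m) ^ r with hP
    set Q := ((1 - M) / M) ^ r with hQ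
    have h := aux_mono T g (fun t => (M * P - m * Q) / (M - m) + (Q - P) / (M - m) * t)
      hgc.continuousOn (by fun_prop) (fun t ht => by
        have ht := hspec ht
        have h := Real.geom_mean_le_arith_mean2_weighted (w₁ := (M - t) / (M - m))
          (w₂ := (t - m) / (M - m)) (p₁ := P) (p₂ := Q)
          (div_nonneg (by linarith [ht.2]) hD.le) (div_nonneg (by linarith [ht.1]) hD.le)
          (Real.rpow_nonneg hA.le _) (Real.rpow_nonneg hB.le _) (hsum t)
        rw [hP, hQ, ← Real.rpow_mul hA.le, ← Real.rpow_mul hB.le, ← hP, ← hQ, ← mul_div_assoc,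
          ← mul_div_assoc, ← hg] at h
        refine h.trans (le_of_eq ?_)
        field_simp
        ring) x
    rw [aux_affine T hT _ _ x hx] at h
    refine h.trans (le_of_eq ?_)
    rw [← hs]
    field_simp
    ring
  · rw [← hg]; exact hkey s hsm
  · rw [← hg]
    set d := r * (b - a) / (M - m) with hd
    have h := aux_mono T (fun t => (g s - g s * d * s) + g s * d * t) g
      (by fun_prop) hgc.continuousOn (fun t _ => by
        have e : g t = g s * Real.exp (d * (t - s)) := by
          rw [hgexp, hgexp, ← Real.exp_add, hd]
          congr 1
          field_simp
          ring
        have hp : 0 < g s := by rw [hgexp]; exact Real.exp_pos _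
        have := mul_le_mul_of_nonneg_left (Real.add_one_le_exp (d * (t - s))) hp.le
        rw [e]; linarith) x
    rw [aux_affine T hT _ _ x hx, ← hs] at h
    linarith
end
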